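/- arXiv:2602.12372 — 5 statements merged into one kernel-verified Lean document; each statement's English description precedes it below -/
import Mathlib

section
/- For every natural number n, the number of permutations of {1,...,n} that avoid the pattern 132 equals the n-th Catalan number C_n. Here a permutation σ of {1,...,n} avoids the pattern 132 if there do not exist indices 1 ≤ i < j < k ≤ n with σ(i) < σ(k) < σ(j). -/
/-- A permutation of `Fin n` avoids the pattern 132. -/
def Avoids132 {n : ℕ} (σ : Equiv.Perm (Fin n)) : Prop :=
  ¬ ∃ i j k : Fin n, i < j ∧ j < k ∧ σ i < σ k ∧ σ k < σ j

namespace Avoids132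

/-- The underlying function of `join σ τ`. -/
def joinFun {a b : ℕ} (σ : Equiv.Perm (Fin a)) (τ : Equiv.Perm (Fin b))
    (i : Fin (a + b + 1)) : Fin (a + b + 1) :=
  if h : (i : ℕ) < a then ⟨b + σ ⟨i, h⟩, by omega⟩
  else if h' : (i : ℕ) = a then ⟨a + b, by omega⟩
  else ⟨τ ⟨i - a - 1, by omega⟩, by omega⟩

section joinFun

variable {a b : ℕ} (σ : Equiv.Perm (Fin a)) (τ : Equiv.Perm (Fin b))

lemma joinFun_of_lt {i : Fin (a + b + 1)} (h : (i : ℕ) < a) :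
    (joinFun σ τ i : ℕ) = b + σ ⟨i, h⟩ := by
  simp [joinFun, h]

lemma joinFun_of_eq {i : Fin (a + b + 1)} (h : (i : ℕ) = a) :
    (joinFun σ τ i : ℕ) = a + b := by
  simp [joinFun, h]

lemma joinFun_of_gt {i : Fin (a + b + 1)} (h : a < (i : ℕ)) :
    (joinFun σ τ i : ℕ) = τ ⟨i - a - 1, by omega⟩ := by
  simp [joinFun, h.not_gt, h.ne']

lemma joinFun_injective : Function.Injective (joinFun σ τ) := by
  intro i j hij
  have hij' := congrArg Fin.val hij
  apply Fin.ext
  rcases lt_trichotomy (i : ℕ) a with hi | hi | hi <;>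
    rcases lt_trichotomy (j : ℕ) a with hj | hj | hj <;>
    simp only [joinFun_of_lt, joinFun_of_eq, joinFun_of_gt, hi, hj] at hij'
  · simpa [Fin.val_inj] using hij'
  · omega
  · omega
  · omega
  · omega
  · omega
  · omega
  · omega
  · simp only [Fin.val_inj, EmbeddingLike.apply_eq_iff_eq, Fin.mk.injEq] at hij'
    omega

/-- The permutation placing a shifted copy of `σ` on the first `a` positions, then the maximum,
then `τ`. -/
noncomputable def join : Equiv.Perm (Fin (a + b + 1)) :=
  Equiv.ofBijective _ (Finite.injective_iff_bijective.1 (joinFun_injective σ τ))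

lemma join_apply (i : Fin (a + b + 1)) : join σ τ i = joinFun σ τ i := rfl

variable {σ τ}

lemma join_avoids (hσ : Avoids132 σ) (hτ : Avoids132 τ) : Avoids132 (join σ τ) := by
  rintro ⟨i, j, k, hij, hjk, hik, hkj⟩
  simp only [join_apply, Fin.lt_def] at hij hjk hik hkj
  rcases lt_trichotomy (i : ℕ) a with hi | hi | hi <;>
    rcases lt_trichotomy (j : ℕ) a with hj | hj | hj <;>
    rcases lt_trichotomy (k : ℕ) a with hk | hk | hk <;>
    simp only [joinFun_of_lt, joinFun_of_eq, joinFun_of_gt, hi, hj, hk] at hik hkj <;>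
    try omega
  · exact hσ ⟨⟨i, hi⟩, ⟨j, hj⟩, ⟨k, hk⟩, hij, hjk, Fin.lt_def.2 (by omega), Fin.lt_def.2 (by omega)⟩
  · exact hτ ⟨⟨i - a - 1, by omega⟩, ⟨j - a - 1, by omega⟩, ⟨k - a - 1, by omega⟩,
      Fin.lt_def.2 (by grind), Fin.lt_def.2 (by grind), hik, hkj⟩

end joinFun

section split

variable {a b : ℕ} {ρ : Equiv.Perm (Fin (a + b + 1))}

lemma apply_lt_apply_of_max (hρ : Avoids132 ρ) (hmax : ρ ⟨a, by omega⟩ = Fin.last (a + b))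
    {i k : Fin (a + b + 1)} (hi : (i : ℕ) < a) (hk : a < (k : ℕ)) : ρ k < ρ i := by
  by_contra! hle
  have hne : ρ i ≠ ρ k := ρ.injective.ne (by grind)
  have hlast : ρ k ≠ Fin.last (a + b) := hmax ▸ ρ.injective.ne (by grind)
  exact hρ ⟨i, ⟨a, by omega⟩, k, hi, hk, lt_of_le_of_ne hle hne,
    hmax ▸ Fin.lt_last_iff_ne_last.2 hlast⟩

lemma le_apply_of_lt_max (hρ : Avoids132 ρ) (hmax : ρ ⟨a, by omega⟩ = Fin.last (a + b))
    {i : Fin (a + b + 1)} (hi : (i : ℕ) < a) : b ≤ ρ i := by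
  have hinj : Function.Injective (fun k : Fin b ↦
      (⟨ρ ⟨a + 1 + k, by omega⟩,
        apply_lt_apply_of_max hρ hmax hi (by simp only []; omega)⟩ : Fin (ρ i))) := by
    intro k l hkl
    simp only [Fin.mk.injEq, Fin.val_inj, EmbeddingLike.apply_eq_iff_eq] at hkl
    omega
  simpa using Fintype.card_le_of_injective _ hinj

lemma apply_lt_of_max_lt (hρ : Avoids132 ρ) (hmax : ρ ⟨a, by omega⟩ = Fin.last (a + b))
    {k : Fin (a + b + 1)} (hk : a < (k : ℕ)) : (ρ k : ℕ) < b := by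
  have hlt (j : ℕ) (hja : j ≤ a) : (ρ k : ℕ) < ρ ⟨j, by omega⟩ := by
    rcases hja.lt_or_eq with hj | hj
    · exact apply_lt_apply_of_max hρ hmax hj hk
    · have hlast : ρ k ≠ Fin.last (a + b) := hmax ▸ ρ.injective.ne (by grind)
      rw [show (⟨j, by omega⟩ : Fin (a + b + 1)) = ⟨a, by omega⟩ from Fin.ext hj, hmax]
      exact Fin.lt_last_iff_ne_last.2 hlast
  have hinj : Function.Injective (fun j : Fin (a + 1) ↦
      (⟨ρ ⟨j, by omega⟩ - ρ k - 1, by have := hlt j (Nat.le_of_lt_succ j.2); omega⟩ : Fin (a + b - ρ k))) := by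
    intro j l hjl
    have hj := hlt j (Nat.le_of_lt_succ j.2)
    have hl := hlt l (Nat.le_of_lt_succ l.2)
    simp only [Fin.mk.injEq] at hjl
    have heq : ρ ⟨j, by omega⟩ = ρ ⟨l, by omega⟩ := Fin.ext (by omega)
    simpa [Fin.val_inj] using heq
  have := Fintype.card_le_of_injective _ hinj
  simp only [Fintype.card_fin] at this
  omega

lemma exists_join_eq (hρ : Avoids132 ρ) (hmax : ρ ⟨a, by omega⟩ = Fin.last (a + b)) :
    ∃ (σ : Equiv.Perm (Fin a)) (τ : Equiv.Perm (Fin b)),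
      Avoids132 σ ∧ Avoids132 τ ∧ join σ τ = ρ := by
  have hleft (i : Fin a) : b ≤ ρ ⟨i, by omega⟩ ∧ (ρ ⟨i, by omega⟩ : ℕ) < a + b := by
    refine ⟨le_apply_of_lt_max hρ hmax i.2, ?_⟩
    have hlast : ρ ⟨i, by omega⟩ ≠ Fin.last (a + b) := hmax ▸ ρ.injective.ne (by grind)
    exact Fin.lt_last_iff_ne_last.2 hlast
  have hright (k : Fin b) : (ρ ⟨a + 1 + k, by omega⟩ : ℕ) < b :=
    apply_lt_of_max_lt hρ hmax (by simp only []; omega)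
  let f (i : Fin a) : Fin a := ⟨ρ ⟨i, by omega⟩ - b, by have := hleft i; omega⟩
  let g (k : Fin b) : Fin b := ⟨ρ ⟨a + 1 + k, by omega⟩, hright k⟩
  have hf : Function.Injective f := by
    intro i j hij
    have hi := hleft i
    have hj := hleft j
    simp only [f, Fin.mk.injEq] at hij
    have heq : ρ ⟨i, by omega⟩ = ρ ⟨j, by omega⟩ := Fin.ext (by omega)
    simpa [Fin.val_inj] using heq
  have hg : Function.Injective g := by
    intro k l hkl
    simp only [g, Fin.mk.injEq, Fin.val_inj, EmbeddingLike.apply_eq_iff_eq] at hkl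
    omega
  refine ⟨Equiv.ofBijective f (Finite.injective_iff_bijective.1 hf),
    Equiv.ofBijective g (Finite.injective_iff_bijective.1 hg), ?_, ?_, ?_⟩
  · rintro ⟨i, j, k, hij, hjk, hik, hkj⟩
    simp only [Equiv.ofBijective_apply, f, Fin.lt_def] at hik hkj
    exact hρ ⟨⟨i, by omega⟩, ⟨j, by omega⟩, ⟨k, by omega⟩, hij, hjk,
      Fin.lt_def.2 (by omega), Fin.lt_def.2 (by omega)⟩
  · rintro ⟨i, j, k, hij, hjk, hik, hkj⟩
    exact hρ ⟨⟨a + 1 + i, by omega⟩, ⟨a + 1 + j, by omega⟩, ⟨a + 1 + k, by omega⟩,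
      Fin.lt_def.2 (by grind), Fin.lt_def.2 (by grind), hik, hkj⟩
  · ext i
    rw [join_apply]
    rcases lt_trichotomy (i : ℕ) a with hi | hi | hi
    · rw [joinFun_of_lt _ _ hi]
      have := hleft ⟨i, hi⟩
      simp only [Equiv.ofBijective_apply, f, Fin.eta] at this ⊢
      omega
    · rw [joinFun_of_eq _ _ hi, show i = ⟨a, by omega⟩ from Fin.ext hi, hmax, Fin.val_last]
    · rw [joinFun_of_gt _ _ hi]
      simp only [Equiv.ofBijective_apply, g]
      rw [show (⟨a + 1 + (i - a - 1), by omega⟩ : Fin (a + b + 1)) = i from Fin.ext (by grind)]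

end split

lemma join_injective {a b : ℕ} {σ σ' : Equiv.Perm (Fin a)} {τ τ' : Equiv.Perm (Fin b)}
    (h : join σ τ = join σ' τ') : σ = σ' ∧ τ = τ' := by
  have happ (i : Fin (a + b + 1)) : (joinFun σ τ i : ℕ) = joinFun σ' τ' i :=
    congrArg Fin.val (DFunLike.congr_fun h i)
  constructor
  · ext i
    have := happ ⟨i, by omega⟩
    rw [joinFun_of_lt _ _ i.2, joinFun_of_lt _ _ i.2] at this
    simpa using this
  · ext k
    have hk : a < a + 1 + (k : ℕ) := by omega
    have := happ ⟨a + 1 + k, by omega⟩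
    rw [joinFun_of_gt _ _ hk, joinFun_of_gt _ _ hk] at this
    simpa [show a + 1 + (k : ℕ) - a - 1 = k by omega] using this

lemma card_max_at (a b : ℕ) :
    Nat.card {ρ : {ρ : Equiv.Perm (Fin (a + b + 1)) // Avoids132 ρ} //
      ρ.1.symm (Fin.last (a + b)) = ⟨a, by omega⟩} =
    Nat.card {σ : Equiv.Perm (Fin a) // Avoids132 σ} *
      Nat.card {τ : Equiv.Perm (Fin b) // Avoids132 τ} := by
  rw [← Nat.card_prod]
  symm
  refine Nat.card_eq_of_bijective (fun p ↦ ⟨⟨join p.1.1 p.2.1, join_avoids p.1.2 p.2.2⟩, ?_⟩)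
    ⟨?_, ?_⟩
  · rw [Equiv.symm_apply_eq]
    exact Fin.ext (joinFun_of_eq _ _ rfl).symm
  · rintro ⟨σ, τ⟩ ⟨σ', τ'⟩ h
    obtain ⟨hσ, hτ⟩ := join_injective (congrArg (·.1.1) h)
    exact Prod.ext (Subtype.ext hσ) (Subtype.ext hτ)
  · rintro ⟨⟨ρ, hρ⟩, hmax⟩
    obtain ⟨σ, τ, hσ, hτ, h⟩ := exists_join_eq hρ ((Equiv.symm_apply_eq _).1 hmax).symm
    exact ⟨⟨⟨σ, hσ⟩, ⟨τ, hτ⟩⟩, Subtype.ext (Subtype.ext h)⟩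

lemma card_succ (n : ℕ) :
    Nat.card {ρ : Equiv.Perm (Fin (n + 1)) // Avoids132 ρ} =
      ∑ p : Fin (n + 1), Nat.card {σ : Equiv.Perm (Fin p) // Avoids132 σ} *
        Nat.card {τ : Equiv.Perm (Fin (n - p)) // Avoids132 τ} := by
  rw [← Nat.card_congr (Equiv.sigmaFiberEquiv
    fun ρ : {ρ : Equiv.Perm (Fin (n + 1)) // Avoids132 ρ} ↦ ρ.1.symm (Fin.last n)),
    Nat.card_sigma]
  refine Finset.sum_congr rfl fun p _ ↦ ?_
  obtain ⟨p, hp⟩ := p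
  generalize hb : n - p = b
  obtain rfl : n = p + b := by omega
  exact card_max_at p b

lemma card_eq_catalan (n : ℕ) :
    Nat.card {σ : Equiv.Perm (Fin n) // Avoids132 σ} = catalan n := by
  induction n using Nat.strong_induction_on with
  | _ n ih =>
    cases n with
    | zero =>
      have : Nonempty {σ : Equiv.Perm (Fin 0) // Avoids132 σ} :=
        ⟨⟨1, fun ⟨i, _⟩ ↦ i.elim0⟩⟩
      rw [catalan_zero, Nat.card_eq_one_iff_unique]
      exact ⟨inferInstance, this⟩
    | succ n =>
      rw [card_succ, catalan_succ]
      refine Finset.sum_congr rfl fun p _ ↦ ?_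
      rw [ih _ (by omega), ih _ (by omega)]

end Avoids132

/-- The number of permutations of `{1,...,n}` (modeled as `Fin n`) avoiding the
pattern 132 equals the `n`-th Catalan number. -/
theorem num_avoiding_132_eq_catalan (n : ℕ) :
    Nat.card {σ : Equiv.Perm (Fin n) //
      ¬ ∃ i j k : Fin n, i < j ∧ j < k ∧ σ i < σ k ∧ σ k < σ j} = catalan n :=
  Avoids132.card_eq_catalan n
end

section
/- For every natural number n, the number of permutations of {1,...,n} that avoid the pattern 231 equals the n-th Catalan number C_n. Here a permutation σ of {1,...,n} avoids the pattern 231 if there do not exist indices 1 ≤ i < j < k ≤ n with σ(k) < σ(i) < σ(j). -/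
/-- `f` restricts to a permutation of `{0, ..., n - 1}` avoiding the pattern 231, and takes the
value `0` elsewhere. -/
structure IsAvoiding231 (n : ℕ) (f : ℕ → ℕ) : Prop where
  lt : ∀ k, k < n → f k < n
  inj : ∀ i j, i < n → j < n → f i = f j → i = j
  avoid : ∀ i j k, i < j → j < k → k < n → f k < f i → f i < f j → False
  zero : ∀ k, n ≤ k → f k = 0

namespace IsAvoiding231

/-- Extension by zero of a permutation of `Fin n` to a function on the natural numbers. -/
def ofPerm {n : ℕ} (σ : Equiv.Perm (Fin n)) (k : ℕ) : ℕ :=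
  if h : k < n then σ ⟨k, h⟩ else 0

theorem ofPerm_val {n : ℕ} (σ : Equiv.Perm (Fin n)) (i : Fin n) : ofPerm σ i = σ i := by
  simp [ofPerm]

theorem isAvoiding231_ofPerm {n : ℕ} (σ : Equiv.Perm (Fin n))
    (hσ : ¬ ∃ i j k : Fin n, i < j ∧ j < k ∧ σ k < σ i ∧ σ i < σ j) :
    IsAvoiding231 n (ofPerm σ) where
  lt k hk := by simp [ofPerm, hk]
  inj i j hi hj h := by
    simpa [ofPerm, hi, hj, Fin.val_inj] using h
  avoid i j k hij hjk hk h₁ h₂ := by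
    have hj := hjk.trans hk
    have hi := hij.trans hj
    simp only [ofPerm, hi, hj, hk, dite_true] at h₁ h₂
    exact hσ ⟨⟨i, hi⟩, ⟨j, hj⟩, ⟨k, hk⟩, hij, hjk, h₁, h₂⟩
  zero k hk := by simp [ofPerm, hk]

theorem exists_ofPerm_eq {n : ℕ} {f : ℕ → ℕ} (hf : IsAvoiding231 n f) :
    ∃ σ : Equiv.Perm (Fin n),
      (¬ ∃ i j k : Fin n, i < j ∧ j < k ∧ σ k < σ i ∧ σ i < σ j) ∧ ofPerm σ = f := by
  let g : Fin n → Fin n := fun i => ⟨f i, hf.lt i i.2⟩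
  have hg : Function.Injective g := fun i j h =>
    Fin.ext (hf.inj i j i.2 j.2 (congrArg Fin.val h))
  refine ⟨Equiv.ofBijective g (Finite.injective_iff_bijective.mp hg), ?_, ?_⟩
  · rintro ⟨i, j, k, hij, hjk, h₁, h₂⟩
    exact hf.avoid i j k hij hjk k.2 h₁ h₂
  · funext k
    by_cases hk : k < n
    · simp [ofPerm, hk, g]
    · simp [ofPerm, hk, hf.zero k (not_lt.mp hk)]

theorem bijective_ofPerm (n : ℕ) : Function.Bijective
    (fun σ : {σ : Equiv.Perm (Fin n) //
        ¬ ∃ i j k : Fin n, i < j ∧ j < k ∧ σ k < σ i ∧ σ i < σ j} =>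
      (⟨ofPerm σ.1, isAvoiding231_ofPerm σ.1 σ.2⟩ : {f // IsAvoiding231 n f})) := by
  constructor
  · intro σ τ h
    refine Subtype.ext (Equiv.ext fun i => Fin.ext ?_)
    rw [← ofPerm_val, ← ofPerm_val]
    exact congrFun (congrArg Subtype.val h) i
  · rintro ⟨f, hf⟩
    obtain ⟨σ, hσ, rfl⟩ := exists_ofPerm_eq hf
    exact ⟨⟨σ, hσ⟩, rfl⟩

instance (n : ℕ) : Finite {f // IsAvoiding231 n f} :=
  Finite.of_surjective _ (bijective_ofPerm n).surjective

/-- The word of length `n + 1` with the maximum `n` at position `p`, preceded by `f` and followed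
by the translate of `g` by `p`. -/
def glue (n p : ℕ) (f g : ℕ → ℕ) (k : ℕ) : ℕ :=
  if k < p then f k else if k = p then n else if k ≤ n then p + g (k - (p + 1)) else 0

theorem isAvoiding231_glue {n p : ℕ} {f g : ℕ → ℕ} (hp : p ≤ n) (hf : IsAvoiding231 p f)
    (hg : IsAvoiding231 (n - p) g) : IsAvoiding231 (n + 1) (glue n p f g) where
  lt k hk := by
    have := hf.lt k
    have := hg.lt (k - (p + 1))
    grind [glue]
  inj i j hi hj h := by
    have := hf.lt i
    have := hf.lt j
    have := hg.lt (i - (p + 1))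
    have := hg.lt (j - (p + 1))
    have := hf.inj i j
    have := hg.inj (i - (p + 1)) (j - (p + 1))
    grind [glue]
  avoid i j k hij hjk hk h₁ h₂ := by
    have := hf.lt i
    have := hf.lt j
    have := hg.lt (i - (p + 1))
    have := hg.lt (j - (p + 1))
    have := hf.avoid i j k
    have := hg.avoid (i - (p + 1)) (j - (p + 1)) (k - (p + 1))
    grind [glue]
  zero k hk := by grind [glue]

theorem position_eq_of_glue_eq {n p q : ℕ} {f g f' g' : ℕ → ℕ} (hp : p ≤ n)
    (hq : q ≤ n) (hf' : IsAvoiding231 q f') (hg' : IsAvoiding231 (n - q) g')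
    (h : glue n p f g = glue n q f' g') : p = q := by
  refine (isAvoiding231_glue hq hf' hg').inj p q (by lia) (by lia) ?_
  rw [← congrFun h p]
  simp [glue]

theorem glue_inj {n p : ℕ} {f g f' g' : ℕ → ℕ}
    (hf : IsAvoiding231 p f) (hg : IsAvoiding231 (n - p) g)
    (hf' : IsAvoiding231 p f') (hg' : IsAvoiding231 (n - p) g')
    (h : glue n p f g = glue n p f' g') : f = f' ∧ g = g' := by
  constructor <;> funext k
  · have := congrFun h k
    have := hf.zero k
    have := hf'.zero k
    grind [glue]
  · have := congrFun h (k + (p + 1))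
    have := hg.zero k
    have := hg'.zero k
    grind [glue]

theorem exists_apply_eq {n : ℕ} {f : ℕ → ℕ} (hf : IsAvoiding231 n f) {v : ℕ} (hv : v < n) :
    ∃ k < n, f k = v := by
  have h := Finset.surjOn_of_injOn_of_card_le (s := Finset.range n) (t := Finset.range n) f
    (fun k hk => by simpa using hf.lt k (by simpa using hk))
    (fun i hi j hj => hf.inj i j (by simpa using hi) (by simpa using hj)) le_rfl
  simpa using h (show v ∈ (Finset.range n : Set ℕ) by simpa using hv)

section Decomposition

variable {n p : ℕ} {f : ℕ → ℕ}

theorem lt_of_lt_max_of_max_lt (hf : IsAvoiding231 (n + 1) f) (hpn : p ≤ n) (hp : f p = n)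
    {i k : ℕ} (hi : i < p) (hk : p < k) (hkn : k ≤ n) : f i < f k := by
  have := hf.avoid i p k hi hk
  have := hf.inj i p
  have := hf.inj i k
  have := hf.lt i
  grind

theorem apply_lt_of_lt_max (hf : IsAvoiding231 (n + 1) f) (hpn : p ≤ n) (hp : f p = n)
    {i : ℕ} (hi : i < p) : f i < p := by
  have hsub : Finset.range (f i + 1) ⊆ (Finset.range p).image f := by
    intro v hv
    have hin := hf.lt i (by lia)
    obtain ⟨k, hk, rfl⟩ := hf.exists_apply_eq (v := v) (by grind)
    have := hf.lt_of_lt_max_of_max_lt hpn hp (k := k) hi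
    have := hf.inj i p
    grind
  have := (Finset.card_le_card hsub).trans Finset.card_image_le
  simp only [Finset.card_range] at this
  lia

theorem le_apply_of_max_lt (hf : IsAvoiding231 (n + 1) f) (hpn : p ≤ n) (hp : f p = n)
    {k : ℕ} (hk : p < k) (hkn : k ≤ n) : p ≤ f k := by
  have h := Finset.card_le_card_of_injOn (s := Finset.range p) (t := Finset.range (f k)) f
    (fun i hi => by
      simpa using hf.lt_of_lt_max_of_max_lt hpn hp (by simpa using hi) hk hkn)
    (fun i hi j hj => hf.inj i j (by grind) (by grind))
  simpa using h

theorem exists_glue_eq (hf : IsAvoiding231 (n + 1) f) :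
    ∃ p ≤ n, ∃ g h, IsAvoiding231 p g ∧ IsAvoiding231 (n - p) h ∧ glue n p g h = f := by
  obtain ⟨p, hpn, hp⟩ := hf.exists_apply_eq (Nat.lt_succ_self n)
  replace hpn : p ≤ n := by lia
  have hlt : ∀ i, i < p → f i < p := fun i => hf.apply_lt_of_lt_max hpn hp
  have hle : ∀ k, p < k → k ≤ n → p ≤ f k := fun k => hf.le_apply_of_max_lt hpn hp
  refine ⟨p, hpn, fun k => if k < p then f k else 0,
    fun k => if k < n - p then f (k + (p + 1)) - p else 0, ?_, ?_, ?_⟩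
  · refine ⟨fun k hk => ?_, fun i j hi hj h => ?_, fun i j k hij hjk hk h₁ h₂ => ?_,
      fun k hk => ?_⟩
    · grind
    · have := hf.inj i j
      grind
    · have := hf.avoid i j k
      grind
    · grind
  · refine ⟨fun k hk => ?_, fun i j hi hj h => ?_, fun i j k hij hjk hk h₁ h₂ => ?_,
      fun k hk => ?_⟩
    · have := hf.lt (k + (p + 1))
      have := hf.inj (k + (p + 1)) p
      grind
    · have := hf.inj (i + (p + 1)) (j + (p + 1))
      have := hle (i + (p + 1))
      have := hle (j + (p + 1))
      grind
    · have := hf.avoid (i + (p + 1)) (j + (p + 1)) (k + (p + 1))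
      grind
    · grind
  · funext k
    have := hf.zero k
    have := hle k
    grind [glue]

end Decomposition

theorem card_succ (n : ℕ) : Nat.card {f // IsAvoiding231 (n + 1) f} =
    ∑ p : Fin (n + 1),
      Nat.card {f // IsAvoiding231 p f} * Nat.card {f // IsAvoiding231 (n - p) f} := by
  simp_rw [← Nat.card_prod]
  rw [← Nat.card_sigma]
  symm
  refine Nat.card_eq_of_bijective
    (fun x => ⟨glue n x.1 x.2.1.1 x.2.2.1,
      isAvoiding231_glue x.1.is_le x.2.1.2 x.2.2.2⟩) ⟨?_, ?_⟩
  · rintro ⟨p, ⟨f, hf⟩, ⟨g, hg⟩⟩ ⟨q, ⟨f', hf'⟩, ⟨g', hg'⟩⟩ h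
    replace h := congrArg Subtype.val h
    obtain rfl : p = q := Fin.ext (position_eq_of_glue_eq p.is_le q.is_le hf' hg' h)
    obtain ⟨rfl, rfl⟩ := glue_inj hf hg hf' hg' h
    rfl
  · rintro ⟨f, hf⟩
    obtain ⟨p, hp, g, h, hg, hh, rfl⟩ := hf.exists_glue_eq
    exact ⟨⟨⟨p, Nat.lt_succ_of_le hp⟩, ⟨g, hg⟩, ⟨h, hh⟩⟩, rfl⟩

theorem card_eq_catalan (n : ℕ) : Nat.card {f // IsAvoiding231 n f} = catalan n := by
  induction n using Nat.strong_induction_on with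
  | _ n ih =>
    cases n with
    | zero =>
      rw [← Nat.card_eq_of_bijective _ (bijective_ofPerm 0), catalan_zero, Nat.card_eq_one_iff_unique]
      exact ⟨inferInstance, ⟨⟨1, fun ⟨i, _⟩ => i.elim0⟩⟩⟩
    | succ n =>
      rw [card_succ, catalan_succ]
      refine Finset.sum_congr rfl fun p _ => ?_
      rw [ih p p.is_lt, ih (n - p) (by lia)]

end IsAvoiding231

/-- The number of permutations of `{1,...,n}` (modeled as `Fin n`) avoiding the
pattern 231 equals the `n`-th Catalan number. -/
theorem num_avoiding_231_eq_catalan (n : ℕ) :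
    Nat.card {σ : Equiv.Perm (Fin n) //
      ¬ ∃ i j k : Fin n, i < j ∧ j < k ∧ σ k < σ i ∧ σ i < σ j} = catalan n := by
  rw [Nat.card_eq_of_bijective _ (IsAvoiding231.bijective_ofPerm n),
    IsAvoiding231.card_eq_catalan]
end

section
/- For all natural numbers m and n, the super Catalan number T(m,n) = (2m)!·(2n)! / ((m+n)!·m!·n!) is an integer, i.e., (m+n)!·m!·n! divides (2m)!·(2n)!. -/
/-- The super Catalan number `T(m,n) = (2m)!(2n)! / ((m+n)! m! n!)` is an integer:
`(m+n)! * m! * n!` divides `(2m)! * (2n)!`. -/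
theorem superCatalan_integer (m n : ℕ) :
    (m + n).factorial * m.factorial * n.factorial ∣
      (2 * m).factorial * (2 * n).factorial := by
  induction n generalizing m with
  | zero =>
    simpa [two_mul] using Nat.factorial_mul_factorial_dvd_factorial_add m m
  | succ n ih =>
    -- The recurrence `4 T(m,n) = T(m+1,n) + T(m,n+1)`.
    obtain ⟨a, ha⟩ := ih m
    obtain ⟨b, hb⟩ := ih (m + 1)
    rw [show m + 1 + n = m + n + 1 by ring, show 2 * (m + 1) = 2 * m + 1 + 1 by ring] at hb
    rw [← Int.natCast_dvd_natCast, ← add_assoc, show 2 * (n + 1) = 2 * n + 1 + 1 by ring]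
    refine ⟨4 * (a : ℤ) - b, ?_⟩
    simp only [Nat.factorial_succ] at hb ⊢
    zify at ha hb
    push_cast
    apply mul_left_cancel₀ (show (m : ℤ) + 1 ≠ 0 by positivity)
    linear_combination
      (4 * (m + n + 1) * (m + 1) * (n + 1) : ℤ) * ha - (n + 1 : ℤ) * hb
end

section
/- Let m ≥ 1, n, k be natural numbers. The Catalan trapezoid entry of order m, defined as C_m(n,k) = binomial(n+k, k) if 0 ≤ k < m, C_m(n,k) = binomial(n+k, k) − binomial(n+k, k−m) if m ≤ k ≤ n+m−1, and C_m(n,k) = 0 if k > n+m−1, equals the number of strings consisting of n X's and k Y's such that in every initial segment the number of Y's exceeds the number of X's by strictly less than m. -/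
/-- The strings with `n` X's (`true`) and `k` Y's (`false`) in all of whose prefixes the number of
Y's is less than the number of X's plus `m`. -/
def ballotStrings (m n k : ℕ) : Set (List Bool) :=
  {l | l.count true = n ∧ l.count false = k ∧
    ∀ p : List Bool, p <+: l → p.count false < p.count true + m}

namespace ballotStrings

theorem forall_prefix_cons {α : Type*} {a : α} {l : List α} {P : List α → Prop} :
    (∀ p, p <+: a :: l → P p) ↔ P [] ∧ ∀ p, p <+: l → P (a :: p) := by
  constructor
  · exact fun h => ⟨h _ List.nil_prefix, fun p hp => h _ (List.cons_prefix_cons.2 ⟨rfl, hp⟩)⟩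
  · rintro ⟨h₀, h⟩ p hp
    obtain rfl | ⟨q, rfl, hq⟩ := List.prefix_cons_iff.1 hp
    exacts [h₀, h q hq]

theorem finite (m n k : ℕ) : (ballotStrings m n k).Finite := by
  refine (List.finite_length_eq Bool (n + k)).subset ?_
  rintro l ⟨h₁, h₂, -⟩
  rw [Set.mem_ofPred_eq, ← List.count_true_add_count_false, h₁, h₂]

theorem nil_mem {m n k : ℕ} : [] ∈ ballotStrings (m + 1) n k ↔ n = 0 ∧ k = 0 := by
  simp [ballotStrings, eq_comm]

theorem true_cons_mem {m n k : ℕ} {l : List Bool} :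
    true :: l ∈ ballotStrings (m + 1) n k ↔ ∃ n', n = n' + 1 ∧ l ∈ ballotStrings (m + 2) n' k := by
  simp only [ballotStrings, Set.mem_ofPred_eq, forall_prefix_cons, List.count_cons_self,
    List.count_cons_of_ne (show true ≠ false by decide), List.count_nil,
    show ∀ a, a + 1 + (m + 1) = a + (m + 2) by omega]
  grind

theorem false_cons_mem {m n k : ℕ} {l : List Bool} :
    false :: l ∈ ballotStrings (m + 1) n k ↔ ∃ k', k = k' + 1 ∧ l ∈ ballotStrings m n k' := by
  simp only [ballotStrings, Set.mem_ofPred_eq, forall_prefix_cons, List.count_cons_self,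
    List.count_cons_of_ne (show false ≠ true by decide), List.count_nil, ← add_assoc,
    Nat.add_lt_add_iff_right]
  grind

theorem eq_empty {m n k : ℕ} (h : n + m ≤ k) : ballotStrings m n k = ∅ := by
  refine Set.eq_empty_of_forall_notMem ?_
  rintro l ⟨h₁, h₂, h₃⟩
  have := h₃ l List.prefix_rfl
  omega

theorem zero_eq_empty (n k : ℕ) : ballotStrings 0 n k = ∅ :=
  Set.eq_empty_of_forall_notMem fun l hl => by simpa using hl.2.2 [] List.nil_prefix

theorem succ_zero_zero (m : ℕ) : ballotStrings (m + 1) 0 0 = {[]} := by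
  ext (_ | ⟨_ | _, l⟩) <;> simp [nil_mem, true_cons_mem, false_cons_mem]

theorem succ_succ_zero (m n : ℕ) :
    ballotStrings (m + 1) (n + 1) 0 = List.cons true '' ballotStrings (m + 2) n 0 := by
  ext (_ | ⟨_ | _, l⟩) <;> simp [nil_mem, true_cons_mem, false_cons_mem]

theorem succ_zero_succ (m k : ℕ) :
    ballotStrings (m + 1) 0 (k + 1) = List.cons false '' ballotStrings m 0 k := by
  ext (_ | ⟨_ | _, l⟩) <;> simp [nil_mem, true_cons_mem, false_cons_mem]

theorem succ_succ_succ (m n k : ℕ) :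
    ballotStrings (m + 1) (n + 1) (k + 1) =
      List.cons true '' ballotStrings (m + 2) n (k + 1) ∪
        List.cons false '' ballotStrings m (n + 1) k := by
  ext (_ | ⟨_ | _, l⟩) <;> simp [nil_mem, true_cons_mem, false_cons_mem]

theorem ncard_succ_succ_succ (m n k : ℕ) :
    (ballotStrings (m + 1) (n + 1) (k + 1)).ncard =
      (ballotStrings (m + 2) n (k + 1)).ncard + (ballotStrings m (n + 1) k).ncard := by
  rw [succ_succ_succ, Set.ncard_union_eq _ ((finite ..).image _) ((finite ..).image _),
    Set.ncard_image_of_injective _ List.cons_injective,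
    Set.ncard_image_of_injective _ List.cons_injective]
  rw [Set.disjoint_left]
  rintro _ ⟨l, -, rfl⟩ ⟨l', -, h⟩
  simp at h

/-- The reflection principle: the second summand counts the strings violating the condition. -/
theorem ncard_add (m n k : ℕ) (h : k ≤ n + m) :
    (ballotStrings m n k).ncard + (if m ≤ k then (n + k).choose (k - m) else 0) =
      (n + k).choose k := by
  match m, n, k with
  | 0, n, k => simp [zero_eq_empty]
  | m + 1, 0, 0 => simp [succ_zero_zero]
  | m + 1, n + 1, 0 =>
    have ih := ncard_add (m + 2) n 0 (by omega)
    rw [succ_succ_zero, Set.ncard_image_of_injective _ List.cons_injective]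
    simpa using ih
  | m + 1, 0, k + 1 =>
    have ih := ncard_add m 0 k (by omega)
    rw [succ_zero_succ, Set.ncard_image_of_injective _ List.cons_injective]
    obtain rfl | hk := eq_or_lt_of_le (show k ≤ m by omega)
    · simpa using ih
    · simpa [hk.not_ge] using ih
  | m + 1, n + 1, k + 1 =>
    have ih₁ := ncard_add (m + 2) n (k + 1) (by omega)
    have ih₂ := ncard_add m (n + 1) k (by omega)
    rw [ncard_succ_succ_succ, show n + 1 + (k + 1) = n + k + 1 + 1 by ring,
      Nat.choose_succ_succ' (n + k + 1) k]
    rw [← add_assoc] at ih₁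
    rw [add_right_comm] at ih₂
    obtain hk | rfl | hk := lt_trichotomy k m
    · rw [if_neg (by omega)] at *
      omega
    · simp at *
      omega
    · obtain ⟨j, rfl⟩ := Nat.exists_eq_add_of_lt hk
      rw [if_pos (by omega)] at *
      rw [show m + j + 1 + 1 - (m + 2) = j by omega] at ih₁
      rw [show m + j + 1 - m = j + 1 by omega] at ih₂
      rw [show m + j + 1 + 1 - (m + 1) = j + 1 by omega, Nat.choose_succ_succ' _ j]
      omega
termination_by n + k

end ballotStrings

/-- The Catalan trapezoid of order `m ≥ 1`: the number of strings of `n` X's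
(here `true`) and `k` Y's (here `false`) such that in every initial segment the
number of Y's exceeds the number of X's by strictly less than `m` is
`choose (n+k) k` if `k < m`, `choose (n+k) k - choose (n+k) (k-m)` if
`m ≤ k ≤ n+m-1`, and `0` if `k > n+m-1`. -/
theorem catalanTrapezoid_counts_strings (m n k : ℕ) (hm : 1 ≤ m) :
    Nat.card {l : List Bool //
        l.count true = n ∧ l.count false = k ∧
        ∀ p : List Bool, p <+: l → p.count false < p.count true + m} =
      if k < m then (n + k).choose k
      else if k ≤ n + m - 1 then (n + k).choose k - (n + k).choose (k - m)
      else 0 := by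
  change (ballotStrings m n k).ncard = _
  by_cases hk : k ≤ n + m - 1
  · have h := ballotStrings.ncard_add m n k (by omega)
    split_ifs at h ⊢ <;> omega
  · rw [ballotStrings.eq_empty (by omega), Set.ncard_empty, if_neg (by omega), if_neg hk]
end

section
/- For all natural numbers m ≥ 1, p, and r ≥ 1 with mp + r > 0, the Fuss–Catalan number A_m(p,r) = (r/(mp+r))·binomial(mp+r, m) is an integer, i.e., mp + r divides r·binomial(mp+r, m). -/
theorem Nat.dvd_mul_choose_self (n k : ℕ) : n ∣ k * n.choose k := by
  cases n with
  | zero => cases k <;> simp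
  | succ n =>
    cases k with
    | zero => simp
    | succ k => exact ⟨n.choose k, by rw [Nat.add_one_mul_choose_eq, mul_comm]⟩

/-- The Fuss–Catalan (Raney) number `A_m(p,r) = (r/(mp+r)) * choose (mp+r) m` is
an integer: `mp + r` divides `r * choose (mp+r) m`. -/
theorem fussCatalan_integer (m p r : ℕ) (hm : 1 ≤ m) (hr : 1 ≤ r)
    (hpos : 0 < m * p + r) :
    (m * p + r) ∣ r * (m * p + r).choose m := by
  have h : (m * p + r) ∣ m * p * (m * p + r).choose m := by
    rw [mul_right_comm]
    exact (Nat.dvd_mul_choose_self _ m).mul_right p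
  rw [← Nat.dvd_add_right h, ← add_mul]
  exact dvd_mul_right _ _
end
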